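/- Let X be a Polish space and u : X → ℝ upper semi-analytic. Then there exists a Borel measurable function f : X → ℝ with u(x) ≤ f(x) for all x ∈ X. (In fact f can be taken with values in the positive integers.) -/

import Mathlib

open MeasureTheory

/-- A predicate on the finite initial segments of sequences of natural numbers which can always be
extended by one more coordinate holds along all initial segments of some sequence. -/
theorem exists_seq_forall_of_forall_exists_update {P : ℕ → (ℕ → ℕ) → Prop}
    (hcongr : ∀ m v w, (∀ j < m, v j = w j) → P m v → P m w) {w₀ : ℕ → ℕ} (h₀ : P 0 w₀)
    (hstep : ∀ m w, P m w → ∃ i, P (m + 1) (Function.update w m i)) :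
    ∃ w, ∀ m, P m w := by
  have hstep' : ∀ m w, ∃ i, P m w → P (m + 1) (Function.update w m i) := fun m w => by
    by_cases h : P m w
    · obtain ⟨i, hi⟩ := hstep m w h
      exact ⟨i, fun _ => hi⟩
    · exact ⟨0, fun h' => absurd h' h⟩
  choose g hg using hstep'
  let W : ℕ → ℕ → ℕ := fun m => Nat.rec w₀ (fun m w => Function.update w m (g m w)) m
  have hW : ∀ m, P m (W m) := fun m => by
    induction m with
    | zero => exact h₀
    | succ m ih => exact hg m _ ih
  have hstat : ∀ j m, j + 1 ≤ m → W m j = W (j + 1) j := fun j m hm => by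
    induction m, hm using Nat.le_induction with
    | base => rfl
    | succ m hm ih =>
      rw [← ih]
      exact Function.update_of_ne (by omega) _ _
  exact ⟨fun j => W (j + 1) j, fun m => hcongr m _ _ (fun j hj => hstat j m hj) (hW m)⟩

/-- A family of sets is measurably jointly separable if its members can be enlarged to measurable
sets with empty intersection. -/
def MeasurablyJointlySeparable {ι α : Type*} [MeasurableSpace α] (s : ι → Set α) : Prop :=
  ∃ t : ι → Set α, (∀ n, s n ⊆ t n) ∧ (∀ n, MeasurableSet (t n)) ∧ ⋂ n, t n = ∅

/-- If one member of a family is the countable union of sets, each of which gives a jointly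
separable family when it replaces that member, then the family is jointly separable. -/
theorem MeasurablyJointlySeparable.of_iUnion {ι κ α : Type*} [Countable κ] [MeasurableSpace α]
    {s : ι → Set α} {r : κ → ι → Set α} (k : ι) (hk : s k ⊆ ⋃ i, r i k)
    (hne : ∀ i, ∀ n ≠ k, s n ⊆ r i n) (h : ∀ i, MeasurablyJointlySeparable (r i)) :
    MeasurablyJointlySeparable s := by
  classical
  choose t hrt ht hempty using h
  refine ⟨fun n => if n = k then ⋃ i, t i n else ⋂ i, t i n, fun n => ?_, fun n => ?_, ?_⟩
  · by_cases hn : n = k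
    · subst hn
      simpa using hk.trans (Set.iUnion_mono fun i => hrt i n)
    · simpa [hn] using fun i => (hne i n hn).trans (hrt i n)
  · dsimp only
    split_ifs
    · exact MeasurableSet.iUnion fun i => ht i n
    · exact MeasurableSet.iInter fun i => ht i n
  · refine Set.eq_empty_of_forall_notMem fun x hx => ?_
    rw [Set.mem_iInter] at hx
    obtain ⟨i, hi⟩ : ∃ i, x ∈ t i k := by simpa using hx k
    refine Set.eq_empty_iff_forall_notMem.1 (hempty i) x (Set.mem_iInter.2 fun n => ?_)
    by_cases hn : n = k
    · exact hn ▸ hi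
    · have := hx n
      simp only [hn, if_false, Set.mem_iInter] at this
      exact this i

/-- A family with two members contained in disjoint measurable sets is jointly separable. -/
theorem MeasurablyJointlySeparable.of_disjoint {ι α : Type*} [MeasurableSpace α] {s : ι → Set α}
    {a b : ι} {u v : Set α} (hu : MeasurableSet u) (hv : MeasurableSet v) (huv : Disjoint u v)
    (ha : s a ⊆ u) (hb : s b ⊆ v) : MeasurablyJointlySeparable s := by
  refine ⟨fun n => {x | (n = a → x ∈ u) ∧ (n = b → x ∈ v)}, fun n x hx => ?_, fun n => ?_, ?_⟩
  · exact ⟨fun h => ha (h ▸ hx), fun h => hb (h ▸ hx)⟩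
  · exact ((MeasurableSet.const _).imp hu).inter ((MeasurableSet.const _).imp hv)
  · refine Set.eq_empty_of_forall_notMem fun x hx => ?_
    rw [Set.mem_iInter] at hx
    exact Set.disjoint_left.1 huv ((hx a).1 rfl) ((hx b).2 rfl)

/-- Novikov's separation theorem for ranges of continuous functions on the Baire space. -/
theorem measurablyJointlySeparable_range {α : Type*} [TopologicalSpace α] [T2Space α]
    [MeasurableSpace α] [OpensMeasurableSpace α] {f : ℕ → (ℕ → ℕ) → α}
    (hf : ∀ n, Continuous (f n)) (h : ⋂ n, Set.range (f n) = ∅) :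
    MeasurablyJointlySeparable fun n => Set.range (f n) := by
  -- A single sequence `w` codes the sequence of points `j ↦ w (Nat.pair n j)` of the Baire space.
  let C : ℕ → (ℕ → ℕ) → ℕ → Set (ℕ → ℕ) := fun m w n =>
    {x | ∀ j, Nat.pair n j < m → x j = w (Nat.pair n j)}
  by_contra hsep
  obtain ⟨w, hw⟩ : ∃ w, ∀ m, ¬ MeasurablyJointlySeparable fun n => f n '' C m w n := by
    refine exists_seq_forall_of_forall_exists_update (w₀ := 0) (fun m v w hvw hv => ?_) ?_
      fun m w hw => ?_
    · have : C m v = C m w := by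
        ext n x
        exact forall₂_congr fun j hj => by rw [hvw _ hj]
      rwa [← this]
    · simpa [C] using hsep
    · contrapose! hw
      refine .of_iUnion m.unpair.1 ?_ (fun i n hn => ?_) hw
      · rintro _ ⟨x, hx, rfl⟩
        refine Set.mem_iUnion.2 ⟨x m.unpair.2, x, fun j hj => ?_, rfl⟩
        obtain hj | hj := Nat.lt_succ_iff_lt_or_eq.1 hj
        · rw [Function.update_of_ne hj.ne, hx j hj]
        · rw [hj, Function.update_self, ← hj, Nat.unpair_pair]
      · refine Set.image_mono fun x hx j hj => ?_
        have hne : Nat.pair n j ≠ m := by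
          rintro rfl
          simp at hn
        rw [Function.update_of_ne hne]
        exact hx j (by omega)
  let x : ℕ → ℕ → ℕ := fun n j => w (Nat.pair n j)
  have hnhds : ∀ n, ∀ u : Set α, IsOpen u → f n (x n) ∈ u →
      ∃ m₀, ∀ m ≥ m₀, f n '' C m w n ⊆ u := by
    intro n u hu hxu
    obtain ⟨_, ⟨y, l, rfl⟩, hxy, hsub⟩ :=
      (PiNat.isTopologicalBasis_cylinders (fun _ : ℕ => ℕ)).mem_nhds_iff.1
        ((hu.preimage (hf n)).mem_nhds hxu)
    refine ⟨Nat.pair n l, fun m hm => ?_⟩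
    rintro _ ⟨z, hz, rfl⟩
    refine hsub fun j hj => ?_
    rw [hz j ((Nat.pair_lt_pair_right n hj).trans_le hm)]
    exact hxy j hj
  obtain ⟨a, hab⟩ : ∃ a, f a (x a) ≠ f 0 (x 0) := by
    by_contra! hall
    exact h.le (Set.mem_iInter.2 fun n => ⟨x n, hall n⟩)
  obtain ⟨u, v, hu, hv, hxu, hxv, huv⟩ := t2_separation hab
  obtain ⟨p, hp⟩ := hnhds a u hu hxu
  obtain ⟨q, hq⟩ := hnhds 0 v hv hxv
  exact hw (max p q) (.of_disjoint hu.measurableSet hv.measurableSet huv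
    (hp _ (le_max_left p q)) (hq _ (le_max_right p q)))

/-- **Novikov's separation theorem**: a sequence of analytic sets with empty intersection can be
enlarged to a sequence of Borel sets with empty intersection. -/
theorem MeasureTheory.AnalyticSet.measurablyJointlySeparable {α : Type*} [TopologicalSpace α]
    [T2Space α] [MeasurableSpace α] [OpensMeasurableSpace α] {s : ℕ → Set α}
    (hs : ∀ n, AnalyticSet (s n)) (h : ⋂ n, s n = ∅) : MeasurablyJointlySeparable s := by
  by_cases hempty : ∃ n, s n = ∅
  · obtain ⟨n, hn⟩ := hempty
    exact .of_disjoint (a := n) (b := n) .empty .empty (Set.disjoint_empty _) hn.le hn.le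
  · push Not at hempty
    have hrange : ∀ n, ∃ f : (ℕ → ℕ) → α, Continuous f ∧ Set.range f = s n := fun n => by
      have := hs n
      rw [AnalyticSet] at this
      exact this.resolve_left (hempty n).ne_empty
    choose f hf hfs using hrange
    obtain rfl : (fun n => Set.range (f n)) = s := funext hfs
    exact measurablyJointlySeparable_range hf h

/-- Every real-valued upper semi-analytic function is dominated by a Borel
function, which can be taken with values in the positive integers. -/
theorem usa_borel_domination {X : Type*} [TopologicalSpace X] [PolishSpace X]
    [MeasurableSpace X] [BorelSpace X]
    (u : X → ℝ)
    (husa : ∀ γ : ℝ, AnalyticSet {x | γ < u x}) :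
    ∃ f : X → ℝ, Measurable f ∧ (∀ x, u x ≤ f x) ∧
      ∀ x, ∃ k : ℕ, 0 < k ∧ f x = (k : ℝ) := by
  classical
  obtain ⟨t, hut, ht, hempty⟩ : MeasurablyJointlySeparable fun n : ℕ => {x | (n : ℝ) < u x} := by
    refine AnalyticSet.measurablyJointlySeparable (fun n => husa n) ?_
    refine Set.eq_empty_of_forall_notMem fun x hx => ?_
    obtain ⟨n, hn⟩ := exists_nat_ge (u x)
    exact hn.not_gt (Set.mem_iInter.1 hx n)
  have hex : ∀ x, ∃ n, x ∉ t n := fun x => by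
    by_contra! hx
    exact hempty.le (Set.mem_iInter.2 hx)
  refine ⟨fun x => ((Nat.find (hex x) + 1 : ℕ) : ℝ), ?_, fun x => ?_,
    fun x => ⟨_, Nat.succ_pos _, rfl⟩⟩
  · exact (measurable_of_countable fun n : ℕ => ((n + 1 : ℕ) : ℝ)).comp
      (measurable_find hex fun n => (ht n).compl)
  · have hle : u x ≤ Nat.find (hex x) := not_lt.1 fun hlt => Nat.find_spec (hex x) (hut _ hlt)
    push_cast
    linarith
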